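/- Suppose premiums are adjusted according to the settled number of claims. Then for every integer u ≥ 0, every i ∈ {1,…,l} and every n ≥ 1: ψ_i(u,n+1) = Σ_{j=1}^l t_{ij}(0)·ψ_j(u+c_i, n)·f_{XY}(0,0) + Σ_{j=1}^l Σ_{x=1}^{u+c_i} t_{ij}(1)·ψ_j(u+c_i−x, n)·f_{XY}(x,0) + (1−q)·Σ_{j=1}^l Σ_{x=1}^{u+c_i−1} Σ_{y=1}^{u+c_i−x} t_{ij}(2)·ψ_j(u+c_i−x−y, n)·f_{XY}(x,y) + q·Σ_{j=1}^l Σ_{x=1}^{u+c_i} Σ_{y=1}^{u+c_i−x+c_j} t_{ij}(1)·ψ'_j(u+c_i−x;y,n)·f_{XY}(x,y) + q·Σ_{j=1}^l Σ_{x=1}^{u+c_i} Σ_{y=u+c_i−x+c_j+1}^∞ t_{ij}(1)·f_{XY}(x,y) + (1−q)·Σ_{y=1}^∞ ξ_y(u+c_i) + Σ_{x=u+c_i+1}^∞ f_X(x), and moreover ψ_i(u,1) = Σ_{x=u+c_i+1}^∞ f_X(x) + (1−q)·Σ_{y=1}^∞ ξ_y(u+c_i). -/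

import Mathlib

open scoped BigOperators

noncomputable section

namespace DelayedClaims

/-- Marginal pmf of the main claim: `f_X(x) = Σ_y f_{XY}(x,y)`. -/
def fX (f : ℕ → ℕ → ℝ) (x : ℕ) : ℝ := ∑' y : ℕ, f x y

/-- `ξ_y(m) = Σ_{x=1}^m f_{XY}(x, y + m - x)`. -/
def xi (f : ℕ → ℕ → ℝ) (y m : ℕ) : ℝ := ∑ x ∈ Finset.Icc 1 m, f x (y + m - x)

/-- Probability weight of a single period outcome `(x, y, d)`:
`d = true` means the settlement of the by-claim `y` is delayed (probability `q`). -/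
def w (f : ℕ → ℕ → ℝ) (q : ℝ) (p : ℕ × ℕ × Bool) : ℝ :=
  f p.1 p.2.1 * (if p.2.2 then q else 1 - q)

/-- Probability weight of an `n`-period path of i.i.d. period outcomes. -/
def pathWeight (f : ℕ → ℕ → ℝ) (q : ℝ) (n : ℕ) (ω : Fin n → ℕ × ℕ × Bool) : ℝ :=
  ∏ s : Fin n, w f q (ω s)

/-- Ruin indicator along a path.  Here `c` lists the premium levels,
`T i s` is the premium level following level `i` when the period adjustment
statistic equals `s`, `stat x y d carry` is the period adjustment statistic,
`i` is the current premium level, `u` the current surplus, and `carry` the amount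
of the by-claim whose settlement was delayed from the previous period (`0` if none).
In each period the premium `c i` is received up front and the settled amount
`x + (1-d)·y + carry` is paid at the end of the period; ruin occurs as soon as
the surplus becomes negative at the end of some period. -/
def ruined (l : ℕ) (c : Fin l → ℕ) (T : Fin l → ℕ → Fin l)
    (stat : ℕ → ℕ → Bool → ℕ → ℕ) :
    (n : ℕ) → (Fin n → ℕ × ℕ × Bool) → Fin l → ℤ → ℕ → Bool
  | 0, _, _, _, _ => false
  | n + 1, ω, i, u, carry =>
    let x : ℕ := (ω 0).1
    let y : ℕ := (ω 0).2.1
    let d : Bool := (ω 0).2.2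
    let u' : ℤ := u + (c i : ℤ) - ((x : ℤ) + (if d then 0 else (y : ℤ)) + (carry : ℤ))
    if u' < 0 then true
    else ruined l c T stat n (fun s => ω s.succ) (T i (stat x y d carry)) u'
      (if d then y else 0)

/-- `ψ'_i(u; z, n)`: the finite-time ruin probability over horizon `n` of the model with
an up-front delayed by-claim `z` settled at the end of period 1 (taking `z = 0` gives the
model without an up-front delayed by-claim), with initial premium level `i` and
initial surplus `u`.  By convention it equals `1` for `u < 0` and `0` for `n = 0`. -/
def psiAux (l : ℕ) (c : Fin l → ℕ) (T : Fin l → ℕ → Fin l)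
    (stat : ℕ → ℕ → Bool → ℕ → ℕ) (f : ℕ → ℕ → ℝ) (q : ℝ)
    (i : Fin l) (u : ℤ) (z : ℕ) (n : ℕ) : ℝ :=
  if u < 0 then 1
  else ∑' ω : Fin n → ℕ × ℕ × Bool,
    pathWeight f q n ω * (if ruined l c T stat n ω i u z then 1 else 0)

/-- `ψ_i(u, n)`: finite-time ruin probability without an up-front delayed by-claim. -/
def psi (l : ℕ) (c : Fin l → ℕ) (T : Fin l → ℕ → Fin l)
    (stat : ℕ → ℕ → Bool → ℕ → ℕ) (f : ℕ → ℕ → ℝ) (q : ℝ)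
    (i : Fin l) (u : ℤ) (n : ℕ) : ℝ :=
  psiAux l c T stat f q i u 0 n

/-- Adjustment statistic: aggregate reported claims `X + Y`. -/
def statRep (x y : ℕ) (_ : Bool) (_ : ℕ) : ℕ := x + y

/-- Adjustment statistic: aggregate settled claims `X + (1-D)·Y + carry`. -/
def statSet (x y : ℕ) (d : Bool) (carry : ℕ) : ℕ := x + (if d then 0 else y) + carry

/-- Adjustment statistic: reported number of claims `1{X>0} + 1{Y>0}`. -/
def statRepN (x y : ℕ) (_ : Bool) (_ : ℕ) : ℕ :=
  (if 0 < x then 1 else 0) + (if 0 < y then 1 else 0)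

/-- Adjustment statistic: settled number of claims
`1{X>0} + 1{Y>0 and not delayed} + 1{delayed by-claim from the previous period}`. -/
def statSetN (x y : ℕ) (d : Bool) (carry : ℕ) : ℕ :=
  (if 0 < x then 1 else 0) + (if 0 < y ∧ d = false then 1 else 0) +
    (if 0 < carry then 1 else 0)

/-- A summable real family on `ℕ`, from index `1` on, splits into an initial segment and a tail. -/
theorem tsum_succ_eq_sum_Icc_add_tail (h : ℕ → ℝ) (hs : Summable h) (N : ℕ) :
    ∑' k : ℕ, h (k + 1) = ∑ y ∈ Finset.Icc 1 N, h y + ∑' k : ℕ, h (N + 1 + k) := by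
  have hs' : Summable fun k => h (k + 1) := (summable_nat_add_iff 1).2 hs
  rw [← hs'.sum_add_tsum_nat_add N, Finset.range_eq_Ico, Finset.sum_Ico_add' h 0 N 1]
  congr 1
  exact tsum_congr fun k => congrArg h (by omega)

theorem summable_pmf {f : ℕ → ℕ → ℝ} (hfsum : ∑' p : ℕ × ℕ, f p.1 p.2 = 1) :
    Summable fun p : ℕ × ℕ => f p.1 p.2 := by
  by_contra h
  rw [tsum_eq_zero_of_not_summable h] at hfsum
  exact zero_ne_one hfsum

theorem w_nonneg {f : ℕ → ℕ → ℝ} (hfnn : ∀ x y, 0 ≤ f x y) {q : ℝ} (hq0 : 0 ≤ q) (hq1 : q ≤ 1)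
    (p : ℕ × ℕ × Bool) : 0 ≤ w f q p := by
  refine mul_nonneg (hfnn _ _) ?_
  split_ifs <;> linarith

theorem hasSum_w {f : ℕ → ℕ → ℝ} (hfnn : ∀ x y, 0 ≤ f x y)
    (hfsum : ∑' p : ℕ × ℕ, f p.1 p.2 = 1) {q : ℝ} (hq0 : 0 ≤ q) (hq1 : q ≤ 1) :
    HasSum (w f q) 1 := by
  have h1 : HasSum (fun p : ℕ × ℕ => f p.1 p.2) 1 := hfsum ▸ (summable_pmf hfsum).hasSum
  have h2 : HasSum (fun d : Bool => if d then q else 1 - q) 1 := by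
    convert hasSum_fintype (fun d : Bool => if d then q else 1 - q) using 1
    simp
  have h3 := h1.mul h2 (h1.summable.mul_of_nonneg h2.summable (fun p => hfnn _ _)
    (fun d => by cases d <;> simp [hq0, hq1]))
  rw [one_mul] at h3
  exact (Equiv.prodAssoc ℕ ℕ Bool).hasSum_iff.1 h3

theorem pathWeight_nonneg {f : ℕ → ℕ → ℝ} (hfnn : ∀ x y, 0 ≤ f x y) {q : ℝ} (hq0 : 0 ≤ q)
    (hq1 : q ≤ 1) (n : ℕ) (ω : Fin n → ℕ × ℕ × Bool) : 0 ≤ pathWeight f q n ω :=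
  Finset.prod_nonneg fun _ _ => w_nonneg hfnn hq0 hq1 _

theorem pathWeight_cons (f : ℕ → ℕ → ℝ) (q : ℝ) (n : ℕ) (p : ℕ × ℕ × Bool)
    (ω : Fin n → ℕ × ℕ × Bool) :
    pathWeight f q (n + 1) (Fin.cons p ω : Fin (n + 1) → ℕ × ℕ × Bool)
      = w f q p * pathWeight f q n ω := by
  simp [pathWeight, Fin.prod_univ_succ]

theorem hasSum_pathWeight {f : ℕ → ℕ → ℝ} (hfnn : ∀ x y, 0 ≤ f x y)
    (hfsum : ∑' p : ℕ × ℕ, f p.1 p.2 = 1) {q : ℝ} (hq0 : 0 ≤ q) (hq1 : q ≤ 1) (n : ℕ) :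
    HasSum (pathWeight f q n) 1 := by
  induction n with
  | zero =>
    convert hasSum_fintype (pathWeight f q 0) using 1
    simp [pathWeight]
  | succ n ih =>
    have hw := hasSum_w hfnn hfsum hq0 hq1
    have h := hw.mul ih (hw.summable.mul_of_nonneg ih.summable (w_nonneg hfnn hq0 hq1)
      (pathWeight_nonneg hfnn hq0 hq1 n))
    rw [one_mul] at h
    refine (Fin.consEquiv fun _ : Fin (n + 1) => ℕ × ℕ × Bool).hasSum_iff.1 ?_
    exact (funext fun p => pathWeight_cons f q n p.1 p.2 :
      pathWeight f q (n + 1) ∘ Fin.consEquiv (fun _ : Fin (n + 1) => ℕ × ℕ × Bool) =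
        fun p => w f q p.1 * pathWeight f q n p.2) ▸ h

section Recursion

variable {l : ℕ} {c : Fin l → ℕ} {T : Fin l → ℕ → Fin l} {stat : ℕ → ℕ → Bool → ℕ → ℕ}
  {f : ℕ → ℕ → ℝ} {q : ℝ}

theorem summable_pathWeight_ruined (hfnn : ∀ x y, 0 ≤ f x y)
    (hfsum : ∑' p : ℕ × ℕ, f p.1 p.2 = 1) (hq0 : 0 ≤ q) (hq1 : q ≤ 1)
    (i : Fin l) (u : ℤ) (z n : ℕ) :
    Summable fun ω : Fin n → ℕ × ℕ × Bool =>
      pathWeight f q n ω * (if ruined l c T stat n ω i u z then (1 : ℝ) else 0) := by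
  refine Summable.of_nonneg_of_le (fun ω => ?_) (fun ω => ?_)
    (hasSum_pathWeight hfnn hfsum hq0 hq1 n).summable
  · exact mul_nonneg (pathWeight_nonneg hfnn hq0 hq1 n ω) (by split_ifs <;> simp)
  · exact mul_le_of_le_one_right (pathWeight_nonneg hfnn hq0 hq1 n ω) (by split_ifs <;> simp)

theorem psiAux_nonneg (hfnn : ∀ x y, 0 ≤ f x y) (hq0 : 0 ≤ q) (hq1 : q ≤ 1)
    (i : Fin l) (u : ℤ) (z n : ℕ) : 0 ≤ psiAux l c T stat f q i u z n := by
  unfold psiAux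
  split_ifs
  · exact zero_le_one
  · exact tsum_nonneg fun ω =>
      mul_nonneg (pathWeight_nonneg hfnn hq0 hq1 n ω) (by split_ifs <;> simp)

theorem psiAux_le_one (hfnn : ∀ x y, 0 ≤ f x y) (hfsum : ∑' p : ℕ × ℕ, f p.1 p.2 = 1)
    (hq0 : 0 ≤ q) (hq1 : q ≤ 1) (i : Fin l) (u : ℤ) (z n : ℕ) :
    psiAux l c T stat f q i u z n ≤ 1 := by
  unfold psiAux
  split_ifs
  · exact le_rfl
  · have h := hasSum_pathWeight hfnn hfsum hq0 hq1 n
    refine ((summable_pathWeight_ruined hfnn hfsum hq0 hq1 i u z n).tsum_le_tsum (fun ω => ?_)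
      h.summable).trans_eq h.tsum_eq
    exact mul_le_of_le_one_right (pathWeight_nonneg hfnn hq0 hq1 n ω) (by split_ifs <;> simp)

theorem psiAux_of_neg {u : ℤ} (hu : u < 0) (i : Fin l) (z n : ℕ) :
    psiAux l c T stat f q i u z n = 1 := if_pos hu

theorem psiAux_zero {u : ℤ} (hu : 0 ≤ u) (i : Fin l) (z : ℕ) :
    psiAux l c T stat f q i u z 0 = 0 := by
  simp [psiAux, not_lt.2 hu, ruined]

/-- Conditioning on the outcome of the first period. -/
theorem psiAux_succ (hfnn : ∀ x y, 0 ≤ f x y) (hfsum : ∑' p : ℕ × ℕ, f p.1 p.2 = 1)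
    (hq0 : 0 ≤ q) (hq1 : q ≤ 1) (i : Fin l) {u : ℤ} (hu : 0 ≤ u) (z n : ℕ) :
    psiAux l c T stat f q i u z (n + 1) = ∑' p : ℕ × ℕ × Bool, w f q p *
      psiAux l c T stat f q (T i (stat p.1 p.2.1 p.2.2 z))
        (u + (c i : ℤ) - ((p.1 : ℤ) + (if p.2.2 then 0 else (p.2.1 : ℤ)) + (z : ℤ)))
        (if p.2.2 then p.2.1 else 0) n := by
  have hs := summable_pathWeight_ruined (c := c) (T := T) (stat := stat) hfnn hfsum hq0 hq1 i u z
    (n + 1)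
  let e := Fin.consEquiv fun _ : Fin (n + 1) => ℕ × ℕ × Bool
  rw [psiAux, if_neg (not_lt.2 hu), ← e.tsum_eq]
  refine (e.summable_iff.2 hs).tsum_prod.trans (tsum_congr fun p => ?_)
  simp only [Function.comp_apply]
  have hcons : ∀ ω : Fin n → ℕ × ℕ × Bool,
      e (p, ω) = (Fin.cons p ω : Fin (n + 1) → ℕ × ℕ × Bool) := fun _ => rfl
  simp only [hcons, pathWeight_cons, mul_assoc, tsum_mul_left]
  congr 1
  simp only [ruined, Fin.cons_zero, Fin.cons_succ, psiAux]
  by_cases h : u + (c i : ℤ) - ((p.1 : ℤ) + (if p.2.2 then 0 else (p.2.1 : ℤ)) + (z : ℤ)) < 0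
  · simpa only [if_pos h, if_true, mul_one] using (hasSum_pathWeight hfnn hfsum hq0 hq1 n).tsum_eq
  · simp only [if_neg h]

/-- Ruin is certain when the up-front by-claim exceeds the first period's funds. -/
theorem psiAux_eq_one_of_lt (hfnn : ∀ x y, 0 ≤ f x y)
    (hfsum : ∑' p : ℕ × ℕ, f p.1 p.2 = 1) (hq0 : 0 ≤ q) (hq1 : q ≤ 1) (i : Fin l) {u : ℤ}
    {z n : ℕ} (hn : 1 ≤ n) (hz : u + c i < z) : psiAux l c T stat f q i u z n = 1 := by
  rcases lt_or_ge u 0 with hu | hu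
  · exact psiAux_of_neg hu i z n
  obtain ⟨n, rfl⟩ := Nat.exists_eq_add_of_le' hn
  rw [psiAux_succ hfnn hfsum hq0 hq1 i hu, ← (hasSum_w hfnn hfsum hq0 hq1).tsum_eq]
  refine tsum_congr fun p => ?_
  rw [psiAux_of_neg, mul_one]
  split_ifs <;> omega

/-- The sum over all outcomes of one period as an iterated sum over both claims. -/
theorem tsum_w_mul (hfnn : ∀ x y, 0 ≤ f x y) (hfsum : ∑' p : ℕ × ℕ, f p.1 p.2 = 1)
    (hq0 : 0 ≤ q) (hq1 : q ≤ 1) (V : ℕ × ℕ × Bool → ℝ) (hV0 : ∀ p, 0 ≤ V p) (hV1 : ∀ p, V p ≤ 1) :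
    Summable (fun p : ℕ × ℕ =>
      f p.1 p.2 * ((1 - q) * V (p.1, p.2, false) + q * V (p.1, p.2, true))) ∧
    ∑' p, w f q p * V p = ∑' x, ∑' y,
      f x y * ((1 - q) * V (x, y, false) + q * V (x, y, true)) := by
  have hs : Summable fun p => w f q p * V p :=
    Summable.of_nonneg_of_le (fun p => mul_nonneg (w_nonneg hfnn hq0 hq1 p) (hV0 p))
      (fun p => mul_le_of_le_one_right (w_nonneg hfnn hq0 hq1 p) (hV1 p))
      (hasSum_w hfnn hfsum hq0 hq1).summable
  let e := Equiv.prodAssoc ℕ ℕ Bool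
  have hs' := e.summable_iff.2 hs
  have hd : ∀ p : ℕ × ℕ, ∑' d : Bool, ((fun p => w f q p * V p) ∘ e) (p, d)
      = f p.1 p.2 * ((1 - q) * V (p.1, p.2, false) + q * V (p.1, p.2, true)) := by
    intro p
    rw [tsum_fintype]
    simp [e, w]
    ring
  have hsum := hs'.prod
  simp only [hd] at hsum
  refine ⟨hsum, ?_⟩
  rw [← e.tsum_eq]
  change ∑' a, ((fun p => w f q p * V p) ∘ e) a = _
  rw [hs'.tsum_prod]
  simp only [hd]
  exact hsum.tsum_prod

/-- One-period decomposition under the settled-number-of-claims rule, without splitting the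
contribution of delayed by-claims. -/
theorem psi_succ_statSetN (hfnn : ∀ x y, 0 ≤ f x y) (hfsum : ∑' p : ℕ × ℕ, f p.1 p.2 = 1)
    (hfdeg : ∀ y : ℕ, 0 < y → f 0 y = 0) (hq0 : 0 ≤ q) (hq1 : q ≤ 1)
    (u : ℕ) (i : Fin l) (n : ℕ) :
    psi l c T statSetN f q i (u : ℤ) (n + 1) =
      psi l c T statSetN f q (T i 0) ((u + c i : ℕ) : ℤ) n * f 0 0
      + (∑ x ∈ Finset.Icc 1 (u + c i),
          psi l c T statSetN f q (T i 1) ((u + c i - x : ℕ) : ℤ) n * f x 0)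
      + (1 - q) * (∑ x ∈ Finset.Icc 1 (u + c i), ∑ y ∈ Finset.Icc 1 (u + c i - x),
          psi l c T statSetN f q (T i 2) ((u + c i - x - y : ℕ) : ℤ) n * f x y)
      + q * (∑ x ∈ Finset.Icc 1 (u + c i), ∑' k : ℕ,
          psiAux l c T statSetN f q (T i 1) ((u + c i - x : ℕ) : ℤ) (k + 1) n * f x (k + 1))
      + (1 - q) * (∑' k : ℕ, xi f (k + 1) (u + c i))
      + (∑' k : ℕ, fX f (u + c i + 1 + k)) := by
  obtain ⟨m, hm⟩ : ∃ m, m = u + c i := ⟨_, rfl⟩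
  have hrow : ∀ x, Summable (f x) := fun x => (summable_pmf hfsum).prod_factor x
  have hrow' : ∀ x (g : ℕ → ℝ), (∀ y, 0 ≤ g y) → (∀ y, g y ≤ 1) →
      Summable fun y => g y * f x y := fun x g h0 h1 =>
    Summable.of_nonneg_of_le (fun y => mul_nonneg (h0 y) (hfnn x y))
      (fun y => mul_le_of_le_one_left (hfnn x y) (h1 y)) (hrow x)
  have h0 := fun j v z => psiAux_nonneg (c := c) (T := T) (stat := statSetN) hfnn hq0 hq1 j v z n
  have h1 := fun j v z =>
    psiAux_le_one (c := c) (T := T) (stat := statSetN) hfnn hfsum hq0 hq1 j v z n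
  rw [psi, psiAux_succ hfnn hfsum hq0 hq1 i (Int.natCast_nonneg u)]
  obtain ⟨hS, hE⟩ := tsum_w_mul hfnn hfsum hq0 hq1
    (fun p : ℕ × ℕ × Bool => psiAux l c T statSetN f q (T i (statSetN p.1 p.2.1 p.2.2 0))
        (u + (c i : ℤ) - ((p.1 : ℤ) + (if p.2.2 then 0 else (p.2.1 : ℤ)) + ((0 : ℕ) : ℤ)))
        (if p.2.2 then p.2.1 else 0) n) (fun p => h0 _ _ _) (fun p => h1 _ _ _)
  rw [hE]
  simp only [Bool.false_eq_true, if_false, if_true, Nat.cast_zero, add_zero] at hS ⊢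
  have hmz : (u : ℤ) + (c i : ℤ) = (m : ℤ) := by rw [hm]; push_cast; ring
  rw [hmz] at hS ⊢
  rw [← hm]
  obtain ⟨a, ha⟩ : ∃ a : ℕ → ℕ → ℝ, a = fun x y => f x y *
      ((1 - q) * psiAux l c T statSetN f q (T i (statSetN x y false 0)) (m - ((x : ℤ) + y)) 0 n
        + q * psiAux l c T statSetN f q (T i (statSetN x y true 0)) (m - (x : ℤ)) y n) := ⟨_, rfl⟩
  have hS' : Summable fun p : ℕ × ℕ => a p.1 p.2 := by rw [ha]; exact hS
  have hgoal : ∑' x, ∑' y, a x y =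
      psi l c T statSetN f q (T i 0) (m : ℤ) n * f 0 0
      + (∑ x ∈ Finset.Icc 1 m,
          psi l c T statSetN f q (T i 1) ((m - x : ℕ) : ℤ) n * f x 0)
      + (1 - q) * (∑ x ∈ Finset.Icc 1 m, ∑ y ∈ Finset.Icc 1 (m - x),
          psi l c T statSetN f q (T i 2) ((m - x - y : ℕ) : ℤ) n * f x y)
      + q * (∑ x ∈ Finset.Icc 1 m, ∑' k : ℕ,
          psiAux l c T statSetN f q (T i 1) ((m - x : ℕ) : ℤ) (k + 1) n * f x (k + 1))
      + (1 - q) * (∑' k : ℕ, xi f (k + 1) m)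
      + (∑' k : ℕ, fX f (m + 1 + k)) := by
    have hA : Summable fun x => ∑' y, a x y := hS'.prod
    rw [hA.tsum_eq_zero_add, tsum_succ_eq_sum_Icc_add_tail _ hA m]
    have hzero : ∑' y, a 0 y = psi l c T statSetN f q (T i 0) (m : ℤ) n * f 0 0 := by
      rw [tsum_eq_single 0 fun y hy => by simp [ha, hfdeg y (Nat.pos_of_ne_zero hy)]]
      simp [ha, statSetN, psi]
      ring
    have htail : ∀ k, ∑' y, a (m + 1 + k) y = fX f (m + 1 + k) := by
      intro k
      refine tsum_congr fun y => ?_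
      rw [ha]
      dsimp only
      rw [psiAux_of_neg (by push_cast; omega), psiAux_of_neg (by push_cast; omega)]
      ring
    have hxi : ∑' k : ℕ, xi f (k + 1) m
        = ∑ x ∈ Finset.Icc 1 m, ∑' k : ℕ, f x (m - x + 1 + k) := by
      unfold xi
      rw [Summable.tsum_finsetSum]
      · refine Finset.sum_congr rfl fun x hx => tsum_congr fun k => congrArg (f x) ?_
        have := (Finset.mem_Icc.1 hx).2
        omega
      · intro x hx
        refine (hrow x).comp_injective (i := fun k => k + 1 + m - x) fun k k' h => ?_
        have := (Finset.mem_Icc.1 hx).2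
        dsimp only at h
        omega
    have hmid : ∀ x ∈ Finset.Icc 1 m, ∑' y, a x y =
        psi l c T statSetN f q (T i 1) ((m - x : ℕ) : ℤ) n * f x 0
        + (1 - q) * ∑ y ∈ Finset.Icc 1 (m - x),
            psi l c T statSetN f q (T i 2) ((m - x - y : ℕ) : ℤ) n * f x y
        + q * ∑' k : ℕ,
            psiAux l c T statSetN f q (T i 1) ((m - x : ℕ) : ℤ) (k + 1) n * f x (k + 1)
        + (1 - q) * ∑' k : ℕ, f x (m - x + 1 + k) := by
      intro x hx
      obtain ⟨hx1, hxm⟩ := Finset.mem_Icc.1 hx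
      have hcast : (m : ℤ) - x = ((m - x : ℕ) : ℤ) := by omega
      have hF : Summable fun y : ℕ =>
          psiAux l c T statSetN f q (T i 2) (m - ((x : ℤ) + y)) 0 n * f x y :=
        hrow' x _ (fun _ => h0 _ _ _) (fun _ => h1 _ _ _)
      have hD : Summable fun y : ℕ =>
          psiAux l c T statSetN f q (T i 1) ((m - x : ℕ) : ℤ) y n * f x y :=
        hrow' x _ (fun _ => h0 _ _ _) (fun _ => h1 _ _ _)
      have hax : Summable fun y => a x y := hS'.prod_factor x
      rw [hax.tsum_eq_zero_add]
      have hx0 : a x 0 = psi l c T statSetN f q (T i 1) ((m - x : ℕ) : ℤ) n * f x 0 := by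
        rw [ha, psi]
        simp only [statSetN, Nat.cast_zero, add_zero, hcast]
        simp [Nat.pos_of_ne_zero (by omega : x ≠ 0)]
        ring
      have hsucc : ∀ k : ℕ, a x (k + 1) =
          (1 - q) * (psiAux l c T statSetN f q (T i 2) (m - ((x : ℤ) + (k + 1 : ℕ))) 0 n
            * f x (k + 1))
          + q * (psiAux l c T statSetN f q (T i 1) ((m - x : ℕ) : ℤ) (k + 1) n
            * f x (k + 1)) := by
        intro k
        have e1 : statSetN x (k + 1) false 0 = 2 := by
          simp [statSetN, Nat.pos_of_ne_zero (by omega : x ≠ 0)]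
        have e2 : statSetN x (k + 1) true 0 = 1 := by
          simp [statSetN, Nat.pos_of_ne_zero (by omega : x ≠ 0)]
        rw [ha]
        dsimp only
        rw [e1, e2, hcast]
        ring
      have hF1 := (summable_nat_add_iff 1).2 hF
      have hD1 := (summable_nat_add_iff 1).2 hD
      rw [hx0, tsum_congr hsucc, (hF1.mul_left (1 - q)).tsum_add (hD1.mul_left q), tsum_mul_left,
        tsum_mul_left, tsum_succ_eq_sum_Icc_add_tail _ hF (m - x)]
      have hin : ∀ y ∈ Finset.Icc 1 (m - x),
          psiAux l c T statSetN f q (T i 2) (m - ((x : ℤ) + y)) 0 n * f x y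
            = psi l c T statSetN f q (T i 2) ((m - x - y : ℕ) : ℤ) n * f x y := by
        intro y hy
        have := (Finset.mem_Icc.1 hy).2
        rw [psi, show (m : ℤ) - ((x : ℤ) + y) = ((m - x - y : ℕ) : ℤ) by omega]
      have hout : ∀ k : ℕ, psiAux l c T statSetN f q (T i 2)
          (m - ((x : ℤ) + (m - x + 1 + k : ℕ))) 0 n * f x (m - x + 1 + k)
            = f x (m - x + 1 + k) := by
        intro k
        rw [psiAux_of_neg (by omega), one_mul]
      rw [Finset.sum_congr rfl hin, tsum_congr hout]
      ring
    rw [hzero, tsum_congr htail, Finset.sum_congr rfl hmid, hxi]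
    simp only [Finset.sum_add_distrib, Finset.mul_sum]
    ring
  rw [← hgoal, ha]

end Recursion

/-- Theorem 4: recursion for ψ when premiums are adjusted according to
the settled number of claims. -/
theorem theorem4_settled_number
    (l : ℕ) (c : Fin l → ℕ) (hcpos : ∀ i, 0 < c i) (hcmono : StrictMono c)
    (f : ℕ → ℕ → ℝ) (hfnn : ∀ x y, 0 ≤ f x y)
    (hfsum : ∑' p : ℕ × ℕ, f p.1 p.2 = 1)
    (hfdeg : ∀ y : ℕ, 0 < y → f 0 y = 0)
    (q : ℝ) (hq0 : 0 ≤ q) (hq1 : q ≤ 1)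
    (t : Fin l → Fin l → ℕ → ℝ) (T : Fin l → ℕ → Fin l)
    (hT : ∀ i j s, t i j s = if j = T i s then (1 : ℝ) else 0)
    (u : ℕ) (i : Fin l) (n : ℕ) (hn : 1 ≤ n) :
    psi l c T statSetN f q i (u : ℤ) (n + 1) =
        (∑ j : Fin l, t i j 0 * psi l c T statSetN f q j ((u + c i : ℕ) : ℤ) n * f 0 0)
      + (∑ j : Fin l, ∑ x ∈ Finset.Icc 1 (u + c i),
          t i j 1 * psi l c T statSetN f q j ((u + c i - x : ℕ) : ℤ) n * f x 0)
      + (1 - q) * (∑ j : Fin l, ∑ x ∈ Finset.Icc 1 (u + c i - 1),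
          ∑ y ∈ Finset.Icc 1 (u + c i - x),
            t i j 2 * psi l c T statSetN f q j ((u + c i - x - y : ℕ) : ℤ) n * f x y)
      + q * (∑ j : Fin l, ∑ x ∈ Finset.Icc 1 (u + c i),
          ∑ y ∈ Finset.Icc 1 (u + c i - x + c j),
            t i j 1 * psiAux l c T statSetN f q j ((u + c i - x : ℕ) : ℤ) y n * f x y)
      + q * (∑ j : Fin l, ∑ x ∈ Finset.Icc 1 (u + c i), ∑' k : ℕ,
          t i j 1 * f x (u + c i - x + c j + 1 + k))
      + (1 - q) * (∑' k : ℕ, xi f (k + 1) (u + c i))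
      + (∑' k : ℕ, fX f (u + c i + 1 + k)) ∧
    psi l c T statSetN f q i (u : ℤ) 1 =
      (∑' k : ℕ, fX f (u + c i + 1 + k))
      + (1 - q) * (∑' k : ℕ, xi f (k + 1) (u + c i)) := by
  have hsel : ∀ (s : ℕ) (F : Fin l → ℝ), (∀ j, t i j s = 0 → F j = 0) →
      ∑ j, F j = F (T i s) := fun s F hF =>
    Finset.sum_eq_single _ (fun j _ hj => hF j (by rw [hT, if_neg hj]))
      (fun h => absurd (Finset.mem_univ _) h)
  have hone : ∀ s, t i (T i s) s = 1 := fun s => by rw [hT, if_pos rfl]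
  constructor
  · rw [psi_succ_statSetN hfnn hfsum hfdeg hq0 hq1 u i n,
      hsel 0 _ fun j hj => by simp [hj], hsel 1 _ fun j hj => by simp [hj],
      hsel 2 _ fun j hj => by simp [hj], hsel 1 _ fun j hj => by simp [hj],
      hsel 1 _ fun j hj => by simp [hj]]
    simp only [hone, one_mul]
    have hsettled : ∑ x ∈ Finset.Icc 1 (u + c i), ∑ y ∈ Finset.Icc 1 (u + c i - x),
          psi l c T statSetN f q (T i 2) ((u + c i - x - y : ℕ) : ℤ) n * f x y
        = ∑ x ∈ Finset.Icc 1 (u + c i - 1), ∑ y ∈ Finset.Icc 1 (u + c i - x),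
          psi l c T statSetN f q (T i 2) ((u + c i - x - y : ℕ) : ℤ) n * f x y := by
      refine (Finset.sum_subset (Finset.Icc_subset_Icc_right (Nat.sub_le _ _)) ?_).symm
      intro x hx hx'
      rw [Finset.mem_Icc] at hx hx'
      rw [show u + c i - x = 0 by omega]
      simp
    have hdelayed : ∀ x ∈ Finset.Icc 1 (u + c i), ∑' k : ℕ,
          psiAux l c T statSetN f q (T i 1) ((u + c i - x : ℕ) : ℤ) (k + 1) n * f x (k + 1)
        = ∑ y ∈ Finset.Icc 1 (u + c i - x + c (T i 1)),
            psiAux l c T statSetN f q (T i 1) ((u + c i - x : ℕ) : ℤ) y n * f x y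
          + ∑' k : ℕ, f x (u + c i - x + c (T i 1) + 1 + k) := by
      intro x _
      rw [tsum_succ_eq_sum_Icc_add_tail
        (fun y => psiAux l c T statSetN f q (T i 1) ((u + c i - x : ℕ) : ℤ) y n * f x y)
        (Summable.of_nonneg_of_le
          (fun y => mul_nonneg (psiAux_nonneg hfnn hq0 hq1 _ _ _ _) (hfnn x y))
          (fun y => mul_le_of_le_one_left (hfnn x y)
            (psiAux_le_one hfnn hfsum hq0 hq1 _ _ _ _))
          ((summable_pmf hfsum).prod_factor x)) (u + c i - x + c (T i 1))]
      congr 1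
      refine tsum_congr fun k => ?_
      rw [psiAux_eq_one_of_lt hfnn hfsum hq0 hq1 _ hn (by push_cast; omega), one_mul]
    rw [hsettled, Finset.sum_congr rfl hdelayed, Finset.sum_add_distrib]
    ring
  · have h := psi_succ_statSetN (c := c) (T := T) hfnn hfsum hfdeg hq0 hq1 u i 0
    simp only [psi, psiAux_zero (Int.natCast_nonneg _), zero_mul, Finset.sum_const_zero,
      tsum_zero, mul_zero, zero_add] at h
    rw [psi, h, add_comm]

end DelayedClaims
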